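/- Let S⁰ be an adequate semigroup with semilattice of idempotents E⁰, L a left adequate semigroup and R a right adequate semigroup such that S⁰ is a quasi-ideal adequate transversal of both L and R, and let ∗ : R × L → S⁰ satisfy conditions (1) and (2). If a ∈ R, x ∈ L, g ∈ E(R) and h ∈ E(L) satisfy ḡ = f_{ā} and h̄ = e_{x̄}, then (ag)∗(hx) = e_a((ag)∗(hx))f_x. In particular, a∗x = e_a(a∗x)f_x for all a ∈ R, x ∈ L. -/

import Mathlib

/-!
Common framework: "relative" semigroup-theoretic notions.  All notions are taken
relative to a carrier set `U` inside an ambient type, together with an explicit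
binary operation `mul` (only the values of `mul` on `U` are relevant).  For an
honest semigroup `S` one takes `U = Set.univ` and `mul = mulOf S`.

* `RStarOn mul U a b` : the relation `a ℛ* b` computed in `U` with an identity
  adjoined (the two clauses correspond to multipliers from `U` and to the
  adjoined identity).
* `LStarOn`, `GreenLOn`, `GreenROn` : dual / Green's relations.
* `AbundantOn`, `AdequateOn`, `LeftAdequateOn`, `RightAdequateOn`.
* `AdequateTransversalOn mul U S0` : `S0` is an adequate `*`-subsemigroup of `U`
  which is an adequate transversal, with the data `bar x = x̄`, `e x = e_x`,
  `f x = f_x`, and `plus s = s⁺`, `star s = s⋆` for `s ∈ S0`.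
* `InverseTransversalOn mul U S0` : `S0` is an inverse transversal of the
  regular semigroup `U`, with `o x = x⁰` the unique inverse of `x` in `S0`.
-/

namespace Paper

universe u

variable {α : Type*} {β : Type*} {γ : Type*}

def mulOf (α : Type*) [Mul α] : α → α → α := fun a b => a * b

/-- `x` is an idempotent for the operation `mul`. -/
def Idem (mul : α → α → α) (x : α) : Prop := mul x x = x

/-- The relation `ℛ*` on `U` (with an identity adjoined to `U`). -/
def RStarOn (mul : α → α → α) (U : Set α) (a b : α) : Prop :=
  (∀ x ∈ U, ∀ y ∈ U, (mul x a = mul y a ↔ mul x b = mul y b)) ∧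
  (∀ x ∈ U, (mul x a = a ↔ mul x b = b))

/-- The relation `ℒ*` on `U` (with an identity adjoined to `U`). -/
def LStarOn (mul : α → α → α) (U : Set α) (a b : α) : Prop :=
  (∀ x ∈ U, ∀ y ∈ U, (mul a x = mul a y ↔ mul b x = mul b y)) ∧
  (∀ x ∈ U, (mul a x = a ↔ mul b x = b))

/-- Green's relation `ℒ` on `U`: `U¹ a = U¹ b`. -/
def GreenLOn (mul : α → α → α) (U : Set α) (a b : α) : Prop :=
  (a = b ∨ ∃ u ∈ U, mul u b = a) ∧ (b = a ∨ ∃ v ∈ U, mul v a = b)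

/-- Green's relation `ℛ` on `U`: `a U¹ = b U¹`. -/
def GreenROn (mul : α → α → α) (U : Set α) (a b : α) : Prop :=
  (a = b ∨ ∃ u ∈ U, mul b u = a) ∧ (b = a ∨ ∃ v ∈ U, mul a v = b)

/-- `U` is closed under `mul`. -/
def ClosedOn (mul : α → α → α) (U : Set α) : Prop :=
  ∀ a ∈ U, ∀ b ∈ U, mul a b ∈ U

/-- `U` with the operation `mul` is a semigroup. -/
def SemigroupOn (mul : α → α → α) (U : Set α) : Prop :=
  ClosedOn mul U ∧ ∀ a ∈ U, ∀ b ∈ U, ∀ c ∈ U, mul (mul a b) c = mul a (mul b c)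

/-- Every `ℛ*`-class and every `ℒ*`-class of `U` contains an idempotent. -/
def AbundantOn (mul : α → α → α) (U : Set α) : Prop :=
  ∀ a ∈ U, (∃ e ∈ U, Idem mul e ∧ RStarOn mul U a e) ∧
           (∃ f ∈ U, Idem mul f ∧ LStarOn mul U a f)

/-- Abundant with commuting idempotents. -/
def AdequateOn (mul : α → α → α) (U : Set α) : Prop :=
  AbundantOn mul U ∧
    ∀ u ∈ U, ∀ v ∈ U, Idem mul u → Idem mul v → mul u v = mul v u

/-- Abundant, and every `ℛ*`-class contains a unique idempotent. -/
def LeftAdequateOn (mul : α → α → α) (U : Set α) : Prop :=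
  AbundantOn mul U ∧
    ∀ u ∈ U, ∀ v ∈ U, Idem mul u → Idem mul v → RStarOn mul U u v → u = v

/-- Abundant, and every `ℒ*`-class contains a unique idempotent. -/
def RightAdequateOn (mul : α → α → α) (U : Set α) : Prop :=
  AbundantOn mul U ∧
    ∀ u ∈ U, ∀ v ∈ U, Idem mul u → Idem mul v → LStarOn mul U u v → u = v

/-- `S0` is a quasi-ideal of `U` : `S0 U S0 ⊆ S0`. -/
def QuasiIdealOn (mul : α → α → α) (U S0 : Set α) : Prop :=
  ∀ s ∈ S0, ∀ x ∈ U, ∀ t ∈ S0, mul (mul s x) t ∈ S0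

/-- Every element of `U` has an inverse in `U`. -/
def RegularOn (mul : α → α → α) (U : Set α) : Prop :=
  ∀ x ∈ U, ∃ u ∈ U, mul (mul x u) x = x ∧ mul (mul u x) u = u

/-- Regular with commuting idempotents, i.e. an inverse semigroup. -/
def InverseSgpOn (mul : α → α → α) (U : Set α) : Prop :=
  RegularOn mul U ∧
    ∀ u ∈ U, ∀ v ∈ U, Idem mul u → Idem mul v → mul u v = mul v u

/-- Regular, and every Green `ℛ`-class contains a unique idempotent. -/
def LeftInverseSgpOn (mul : α → α → α) (U : Set α) : Prop :=
  RegularOn mul U ∧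
    ∀ u ∈ U, ∀ v ∈ U, Idem mul u → Idem mul v → GreenROn mul U u v → u = v

/-- Regular, and every Green `ℒ`-class contains a unique idempotent. -/
def RightInverseSgpOn (mul : α → α → α) (U : Set α) : Prop :=
  RegularOn mul U ∧
    ∀ u ∈ U, ∀ v ∈ U, Idem mul u → Idem mul v → GreenLOn mul U u v → u = v

/-- An isomorphism from `(A, mulA)` onto `(B, mulB)`. -/
def IsoOn (mulA : α → α → α) (mulB : β → β → β) (A : Set α) (B : Set β) : Prop :=
  ∃ θ : α → β, Set.BijOn θ A B ∧ ∀ a ∈ A, ∀ b ∈ A, θ (mulA a b) = mulB (θ a) (θ b)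

/-- `S0` is an adequate transversal of the abundant semigroup `U`.  `S0` is an
adequate `*`-subsemigroup of `U` (witnessed by `plus`/`star`, the canonical
idempotents `a⁺ ℛ* a`, `a⋆ ℒ* a` of elements of `S0`, the `ℛ*`/`ℒ*` relations
being those of the big semigroup `U`, which gives the `*`-subsemigroup property),
and every `x ∈ U` factors uniquely as `x = e_x x̄ f_x` with `x̄ ∈ S0`,
`e_x, f_x` idempotents of `U`, `e_x ℒ x̄⁺` and `f_x ℛ x̄⋆`. -/
structure AdequateTransversalOn (mul : α → α → α) (U S0 : Set α) where
  sub : S0 ⊆ U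
  mul_mem : ∀ a ∈ S0, ∀ b ∈ S0, mul a b ∈ S0
  bar : α → α
  e : α → α
  f : α → α
  plus : α → α
  star : α → α
  plus_mem : ∀ a ∈ S0, plus a ∈ S0
  plus_idem : ∀ a ∈ S0, Idem mul (plus a)
  plus_rstar : ∀ a ∈ S0, RStarOn mul U a (plus a)
  star_mem : ∀ a ∈ S0, star a ∈ S0
  star_idem : ∀ a ∈ S0, Idem mul (star a)
  star_lstar : ∀ a ∈ S0, LStarOn mul U a (star a)
  idem_comm : ∀ u ∈ S0, ∀ v ∈ S0, Idem mul u → Idem mul v → mul u v = mul v u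
  bar_mem : ∀ x ∈ U, bar x ∈ S0
  e_mem : ∀ x ∈ U, e x ∈ U
  f_mem : ∀ x ∈ U, f x ∈ U
  e_idem : ∀ x ∈ U, Idem mul (e x)
  f_idem : ∀ x ∈ U, Idem mul (f x)
  decomp : ∀ x ∈ U, x = mul (mul (e x) (bar x)) (f x)
  e_greenL : ∀ x ∈ U, GreenLOn mul U (e x) (plus (bar x))
  f_greenR : ∀ x ∈ U, GreenROn mul U (f x) (star (bar x))
  unique : ∀ x ∈ U, ∀ s ∈ S0, ∀ e' ∈ U, ∀ f' ∈ U, Idem mul e' → Idem mul f' →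
      x = mul (mul e' s) f' → GreenLOn mul U e' (plus s) → GreenROn mul U f' (star s) →
      s = bar x ∧ e' = e x ∧ f' = f x

namespace AdequateTransversalOn

variable {mul : α → α → α} {U S0 : Set α}

/-- `R = {x ∈ U : e_x = e_{x̄}}`. -/
def Rset (T : AdequateTransversalOn mul U S0) : Set α :=
  {x | x ∈ U ∧ T.e x = T.e (T.bar x)}

/-- `L = {x ∈ U : f_x = f_{x̄}}`. -/
def Lset (T : AdequateTransversalOn mul U S0) : Set α :=
  {x | x ∈ U ∧ T.f x = T.f (T.bar x)}

/-- `I = {e_x : x ∈ U}`. -/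
def Iset (T : AdequateTransversalOn mul U S0) : Set α :=
  {y | ∃ x ∈ U, T.e x = y}

/-- `Λ = {f_x : x ∈ U}`. -/
def LamSet (T : AdequateTransversalOn mul U S0) : Set α :=
  {y | ∃ x ∈ U, T.f x = y}

/-- The transversal is multiplicative: `Λ I ⊆ E⁰`. -/
def IsMultiplicative (T : AdequateTransversalOn mul U S0) : Prop :=
  ∀ l ∈ T.LamSet, ∀ i ∈ T.Iset, mul l i ∈ S0 ∧ Idem mul (mul l i)

end AdequateTransversalOn

/-- The spined product set `T = L |×| R ⊆ S × S` attached to an adequate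
transversal of `S` (ambient carrier `U`). -/
def spSet {mul : α → α → α} {U S0 : Set α}
    (T : AdequateTransversalOn mul U S0) : Set (α × α) :=
  {p | p.1 ∈ T.Lset ∧ p.2 ∈ T.Rset ∧ T.bar p.1 = T.bar p.2}

/-- The multiplication `(x,a)(y,b) = (e_x(ay), (ay) f_b)` on the spined product. -/
def spMul {mul : α → α → α} {U S0 : Set α}
    (T : AdequateTransversalOn mul U S0) : α × α → α × α → α × α :=
  fun p q => (mul (T.e p.1) (mul p.2 q.1), mul (mul p.2 q.1) (T.f q.2))

/-- The map `φ : S → T`, `x ↦ (e_x x̄, x̄ f_x)`. -/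
def phiMap {mul : α → α → α} {U S0 : Set α}
    (T : AdequateTransversalOn mul U S0) : α → α × α :=
  fun x => (mul (T.e x) (T.bar x), mul (T.bar x) (T.f x))

/-- `T⁰ = {(s,s) : s ∈ S0}`. -/
def diagSet (S0 : Set α) : Set (α × α) := {p | ∃ s ∈ S0, p = (s, s)}

/-- Abstract spined product `L |×| R` over a common transversal `S⁰` (a type `γ`
embedded into `L` and `R` by `jL`, `jR`). -/
def absTset {mulL : α → α → α} {mulR : β → β → β} {jL : γ → α} {jR : γ → β}
    (TL : AdequateTransversalOn mulL Set.univ (Set.range jL))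
    (TR : AdequateTransversalOn mulR Set.univ (Set.range jR)) : Set (α × β) :=
  {p | ∃ s : γ, jL s = TL.bar p.1 ∧ jR s = TR.bar p.2}

/-- The multiplication `(x,a)(y,b) = (e_x(a∗y), (a∗y) f_b)`. -/
def absMul {mulL : α → α → α} {mulR : β → β → β} {jL : γ → α} {jR : γ → β}
    (TL : AdequateTransversalOn mulL Set.univ (Set.range jL))
    (TR : AdequateTransversalOn mulR Set.univ (Set.range jR))
    (st : β → α → γ) : α × β → α × β → α × β :=
  fun p q => (mulL (TL.e p.1) (jL (st p.2 q.1)), mulR (jR (st p.2 q.1)) (TR.f q.2))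

/-- `T⁰ = {(s,s) : s ∈ S⁰}` inside `L × R`, where `s` is viewed in `L` and in `R`. -/
def absT0 (jL : γ → α) (jR : γ → β) : Set (α × β) :=
  {p | ∃ s : γ, p = (jL s, jR s)}

/-- `S0` is an inverse transversal of the regular semigroup `U`: an inverse
subsemigroup meeting the set of inverses of each `x ∈ U` in exactly one
element `o x = x⁰`. -/
structure InverseTransversalOn (mul : α → α → α) (U S0 : Set α) where
  sub : S0 ⊆ U
  mul_mem : ∀ a ∈ S0, ∀ b ∈ S0, mul a b ∈ S0
  o : α → α
  o_mem : ∀ x ∈ U, o x ∈ S0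
  o_inv1 : ∀ x ∈ U, mul (mul x (o x)) x = x
  o_inv2 : ∀ x ∈ U, mul (mul (o x) x) (o x) = o x
  o_unique : ∀ x ∈ U, ∀ u ∈ S0, mul (mul x u) x = x → mul (mul u x) u = u → u = o x
  idem_comm : ∀ u ∈ S0, ∀ v ∈ S0, Idem mul u → Idem mul v → mul u v = mul v u

namespace InverseTransversalOn

variable {mul : α → α → α} {U S0 : Set α}

/-- `L = {x ∈ U : x⁰x ∈ E⁰}`. -/
def LsetI (T : InverseTransversalOn mul U S0) : Set α :=
  {x | x ∈ U ∧ mul (T.o x) x ∈ S0 ∧ Idem mul (mul (T.o x) x)}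

/-- `R = {x ∈ U : xx⁰ ∈ E⁰}`. -/
def RsetI (T : InverseTransversalOn mul U S0) : Set α :=
  {x | x ∈ U ∧ mul x (T.o x) ∈ S0 ∧ Idem mul (mul x (T.o x))}

end InverseTransversalOn

/-- Spined product set for an inverse transversal: `{(x,a) : x⁰ = a⁰}`. -/
def invSpSet {mul : α → α → α} {U S0 : Set α}
    (T : InverseTransversalOn mul U S0) : Set (α × α) :=
  {p | p.1 ∈ T.LsetI ∧ p.2 ∈ T.RsetI ∧ T.o p.1 = T.o p.2}

/-- The multiplication `(x,a)(y,b) = ((xx⁰)(ay), (ay)(b⁰b))`. -/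
def invSpMul {mul : α → α → α} {U S0 : Set α}
    (T : InverseTransversalOn mul U S0) : α × α → α × α → α × α :=
  fun p q => (mul (mul p.1 (T.o p.1)) (mul p.2 q.1),
              mul (mul p.2 q.1) (mul (T.o q.2) q.2))

/-- Abstract spined product for inverse transversals: `{(x,a) : x⁰ = a⁰}`. -/
def invAbsTset {mulL : α → α → α} {mulR : β → β → β} {jL : γ → α} {jR : γ → β}
    (TL : InverseTransversalOn mulL Set.univ (Set.range jL))
    (TR : InverseTransversalOn mulR Set.univ (Set.range jR)) : Set (α × β) :=
  {p | ∃ s : γ, jL s = TL.o p.1 ∧ jR s = TR.o p.2}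

/-- The multiplication `(x,a)(y,b) = ((xx⁰)(a∗y), (a∗y)(b⁰b))`. -/
def invAbsMul {mulL : α → α → α} {mulR : β → β → β} {jL : γ → α} {jR : γ → β}
    (TL : InverseTransversalOn mulL Set.univ (Set.range jL))
    (TR : InverseTransversalOn mulR Set.univ (Set.range jR))
    (st : β → α → γ) : α × β → α × β → α × β :=
  fun p q => (mulL (mulL p.1 (TL.o p.1)) (jL (st p.2 q.1)),
              mulR (jR (st p.2 q.1)) (mulR (TR.o q.2) q.2))

/-- The multiplication `(e,x)(g,w) = (e(aa⁻¹), a)`, `a = x((x⁻¹x)g)w`, on `I × S⁰`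
(Chen-style construction from a left normal band `I` with semilattice transversal
`E⁰ = E(S⁰)`; `σ` embeds idempotents of the inverse semigroup `γ` into the band
`β`, and `π : β → γ` is the semilattice-transversal map `e ↦ e⁰`). -/
def bandMul (mulB : β → β → β) (mulG : γ → γ → γ) (σ : γ → β) (π : β → γ)
    (inv : γ → γ) (p q : β × γ) : β × γ :=
  let a := mulG (mulG p.2 (π (mulB (σ (mulG (inv p.2) p.2)) q.1))) q.2
  (mulB p.1 (σ (mulG a (inv a))), a)

/-- `T = {(e,x) : e⁰ = xx⁻¹}`. -/
def bandTset (mulG : γ → γ → γ) (π : β → γ) (inv : γ → γ) : Set (β × γ) :=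
  {p | π p.1 = mulG p.2 (inv p.2)}

/-- `T⁰ = {(aa⁻¹, a) : a ∈ S⁰}` (with `aa⁻¹` viewed in the band via `σ`). -/
def bandT0 (mulG : γ → γ → γ) (σ : γ → β) (inv : γ → γ) : Set (β × γ) :=
  {p | ∃ s : γ, p = (σ (mulG s (inv s)), s)}

end Paper

namespace Paper

section Green

variable {S : Type*} [Semigroup S] {u v : S}

theorem Idem.lStarOn_of_greenLOn (hu : Idem (mulOf S) u) (hv : Idem (mulOf S) v)
    (h : GreenLOn (mulOf S) Set.univ u v) : LStarOn (mulOf S) Set.univ u v := by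
  simp only [Idem, mulOf] at hu hv
  have huv : u * v = u := by
    rcases h.1 with rfl | ⟨w, -, hw⟩
    · exact hu
    · rw [← hw, mulOf, mul_assoc, hv]
  have hvu : v * u = v := by
    rcases h.2 with rfl | ⟨w, -, hw⟩
    · exact hu
    · rw [← hw, mulOf, mul_assoc, hu]
  simp only [LStarOn, mulOf]
  refine ⟨fun x _ y _ => ⟨fun hxy => ?_, fun hxy => ?_⟩, fun x _ => ⟨fun hx => ?_, fun hx => ?_⟩⟩
  · rw [← hvu, mul_assoc, hxy, mul_assoc]
  · rw [← huv, mul_assoc, hxy, mul_assoc]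
  · rw [← hvu, mul_assoc, hx]
  · rw [← huv, mul_assoc, hx]

theorem Idem.rStarOn_of_greenROn (hu : Idem (mulOf S) u) (hv : Idem (mulOf S) v)
    (h : GreenROn (mulOf S) Set.univ u v) : RStarOn (mulOf S) Set.univ u v := by
  simp only [Idem, mulOf] at hu hv
  have hvu : v * u = u := by
    rcases h.1 with rfl | ⟨w, -, hw⟩
    · exact hu
    · rw [← hw, mulOf, ← mul_assoc, hv]
  have huv : u * v = v := by
    rcases h.2 with rfl | ⟨w, -, hw⟩
    · exact hu
    · rw [← hw, mulOf, ← mul_assoc, hu]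
  simp only [RStarOn, mulOf]
  refine ⟨fun x _ y _ => ⟨fun hxy => ?_, fun hxy => ?_⟩, fun x _ => ⟨fun hx => ?_, fun hx => ?_⟩⟩
  · rw [← huv, ← mul_assoc, hxy, mul_assoc]
  · rw [← hvu, ← mul_assoc, hxy, mul_assoc]
  · rw [← huv, ← mul_assoc, hx]
  · rw [← hvu, ← mul_assoc, hx]

end Green

namespace AdequateTransversalOn

variable {S : Type*} [Semigroup S] {S0 : Set S}
  (T : AdequateTransversalOn (mulOf S) Set.univ S0)

theorem plus_mul_self {s : S} (hs : s ∈ S0) : T.plus s * s = s :=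
  ((T.plus_rstar s hs).2 _ trivial).2 (T.plus_idem s hs)

theorem self_mul_star {s : S} (hs : s ∈ S0) : s * T.star s = s :=
  ((T.star_lstar s hs).2 _ trivial).2 (T.star_idem s hs)

theorem decomp_of_mem {s : S} (hs : s ∈ S0) :
    s = T.bar s ∧ T.plus s = T.e s ∧ T.star s = T.f s :=
  T.unique s trivial s hs _ trivial _ trivial (T.plus_idem s hs) (T.star_idem s hs)
    (by rw [mulOf, mulOf, T.plus_mul_self hs, T.self_mul_star hs])
    ⟨.inl rfl, .inl rfl⟩ ⟨.inl rfl, .inl rfl⟩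

theorem e_mul_self (x : S) : T.e x * x = x := by
  have hd : x = T.e x * T.bar x * T.f x := T.decomp x trivial
  have hi : T.e x * T.e x = T.e x := T.e_idem x trivial
  calc T.e x * x = T.e x * T.e x * T.bar x * T.f x := by
        rw [mul_assoc (T.e x) (T.e x), mul_assoc (T.e x), ← hd]
    _ = x := by rw [hi, ← hd]

theorem self_mul_f (x : S) : x * T.f x = x := by
  have hd : x = T.e x * T.bar x * T.f x := T.decomp x trivial
  have hi : T.f x * T.f x = T.f x := T.f_idem x trivial
  calc x * T.f x = T.e x * T.bar x * (T.f x * T.f x) := by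
        rw [← mul_assoc, ← hd]
    _ = x := by rw [hi, ← hd]

theorem bar_mul_f (hS : RightAdequateOn (mulOf S) Set.univ) (x : S) :
    T.bar x * T.f x = x := by
  have hb := T.bar_mem x trivial
  have he : T.e x = T.plus (T.bar x) :=
    hS.2 _ trivial _ trivial (T.e_idem x trivial) (T.plus_idem _ hb)
      ((T.e_idem x trivial).lStarOn_of_greenLOn (T.plus_idem _ hb) (T.e_greenL x trivial))
  have hd : x = T.e x * T.bar x * T.f x := T.decomp x trivial
  rwa [he, T.plus_mul_self hb, eq_comm] at hd

theorem e_mul_bar (hS : LeftAdequateOn (mulOf S) Set.univ) (x : S) :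
    T.e x * T.bar x = x := by
  have hb := T.bar_mem x trivial
  have hf : T.f x = T.star (T.bar x) :=
    hS.2 _ trivial _ trivial (T.f_idem x trivial) (T.star_idem _ hb)
      ((T.f_idem x trivial).rStarOn_of_greenROn (T.star_idem _ hb) (T.f_greenR x trivial))
  have hd : x = T.e x * T.bar x * T.f x := T.decomp x trivial
  rwa [hf, mul_assoc, T.self_mul_star hb, eq_comm] at hd

end AdequateTransversalOn

/-- The product `∗` commutes with left multiplication by the transversal. -/
theorem star_mul_left
    {L R G : Type*} [Semigroup L] [Semigroup R] [Semigroup G] {jL : G → L} {jR : G → R}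
    (hjL : Function.Injective jL) (hjR : Function.Injective jR)
    (hjLm : ∀ s t : G, jL (s * t) = jL s * jL t)
    (hjRm : ∀ s t : G, jR (s * t) = jR s * jR t)
    (hG : AdequateOn (mulOf G) Set.univ)
    (TL : AdequateTransversalOn (mulOf L) Set.univ (Set.range jL))
    (TR : AdequateTransversalOn (mulOf R) Set.univ (Set.range jR))
    {st : R → L → G}
    (cond1 : ∀ (y z : L) (a b : R),
      (∃ s : G, jL s = TL.bar y ∧ jR s = TR.bar b) →
      st (jR (st a y) * TR.f b) z = st a (TL.e y * jL (st b z)))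
    (cond2L : ∀ (s : G) (x : L), jL (st (jR s) x) = jL s * x)
    (cond2R : ∀ (a : R) (s : G), jR (st a (jL s)) = a * jR s)
    (hR : RightAdequateOn (mulOf R) Set.univ) (u : G) (b : R) (z : L) :
    st (jR u * b) z = u * st b z := by
  obtain ⟨s, hs⟩ := TR.bar_mem b trivial
  have hsL : jL s ∈ Set.range jL := ⟨s, rfl⟩
  have hsR : jR s ∈ Set.range jR := ⟨s, rfl⟩
  obtain ⟨hbar, he, -⟩ := TL.decomp_of_mem hsL
  obtain ⟨p, hp⟩ := TL.plus_mem _ hsL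
  obtain ⟨q, hq⟩ := TR.plus_mem _ hsR
  have hb : jR s * TR.f b = b := hs ▸ TR.bar_mul_f hR b
  have key (v : G) : st (jR v * b) z = v * (p * st b z) := by
    have h := cond1 (jL s) z (jR v) b ⟨s, hbar, hs⟩
    rw [cond2R, mul_assoc, hb, ← he, ← hp] at h
    apply hjL
    rw [h, cond2L, hjLm, hjLm]
  have hpp : p * p = p := hjL (by rw [hjLm, hp]; exact TL.plus_idem _ hsL)
  have hqq : q * q = q := hjR (by rw [hjRm, hq]; exact TR.plus_idem _ hsR)
  have hpq : p * q = q * p := hG.2 _ trivial _ trivial hpp hqq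
  have hqb : jR q * b = b := by
    rw [← hb, ← mul_assoc, hq, TR.plus_mul_self hsR]
  have h := key q
  rw [hqb] at h
  have hpst : p * st b z = st b z := by
    conv_lhs => rw [h]
    rw [← mul_assoc, hpq, mul_assoc, ← mul_assoc p p, hpp, ← h]
  rw [key, hpst]

/-- The product `∗` commutes with right multiplication by the transversal. -/
theorem star_mul_right
    {L R G : Type*} [Semigroup L] [Semigroup R] [Semigroup G] {jL : G → L} {jR : G → R}
    (hjL : Function.Injective jL) (hjR : Function.Injective jR)
    (hjLm : ∀ s t : G, jL (s * t) = jL s * jL t)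
    (hjRm : ∀ s t : G, jR (s * t) = jR s * jR t)
    (hG : AdequateOn (mulOf G) Set.univ)
    (TL : AdequateTransversalOn (mulOf L) Set.univ (Set.range jL))
    (TR : AdequateTransversalOn (mulOf R) Set.univ (Set.range jR))
    {st : R → L → G}
    (cond1 : ∀ (y z : L) (a b : R),
      (∃ s : G, jL s = TL.bar y ∧ jR s = TR.bar b) →
      st (jR (st a y) * TR.f b) z = st a (TL.e y * jL (st b z)))
    (cond2L : ∀ (s : G) (x : L), jL (st (jR s) x) = jL s * x)
    (cond2R : ∀ (a : R) (s : G), jR (st a (jL s)) = a * jR s)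
    (hL : LeftAdequateOn (mulOf L) Set.univ) (a : R) (y : L) (u : G) :
    st a (y * jL u) = st a y * u := by
  obtain ⟨s, hs⟩ := TL.bar_mem y trivial
  have hsL : jL s ∈ Set.range jL := ⟨s, rfl⟩
  have hsR : jR s ∈ Set.range jR := ⟨s, rfl⟩
  obtain ⟨hbar, -, hf⟩ := TR.decomp_of_mem hsR
  obtain ⟨p, hp⟩ := TR.star_mem _ hsR
  obtain ⟨q, hq⟩ := TL.star_mem _ hsL
  have hy : TL.e y * jL s = y := hs ▸ TL.e_mul_bar hL y
  have key (v : G) : st a (y * jL v) = st a y * p * v := by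
    have h := cond1 y (jL v) a (jR s) ⟨s, hs, hbar⟩
    rw [cond2L, ← mul_assoc, hy, ← hf, ← hp] at h
    apply hjR
    rw [← h, cond2R, hjRm, hjRm]
  have hpp : p * p = p := hjR (by rw [hjRm, hp]; exact TR.star_idem _ hsR)
  have hqq : q * q = q := hjL (by rw [hjLm, hq]; exact TL.star_idem _ hsL)
  have hpq : p * q = q * p := hG.2 _ trivial _ trivial hpp hqq
  have hyq : y * jL q = y := by
    rw [← hy, mul_assoc, hq, TL.self_mul_star hsL]
  have h := key q
  rw [hyq] at h
  have hpst : st a y * p = st a y := by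
    conv_lhs => rw [h]
    rw [mul_assoc, ← hpq, ← mul_assoc, mul_assoc (st a y), hpp, ← h]
  rw [key, hpst]

end Paper

open Paper in
/-- **Lemma `sub-lemma`.** If `a ∈ R`, `x ∈ L`, `g ∈ E(R)`,
`h ∈ E(L)` with `ḡ = f_{ā}` and `h̄ = e_{x̄}`, then
`(ag)∗(hx) = e_a ((ag)∗(hx)) f_x`; in particular `a∗x = e_a(a∗x)f_x`.
(The elements `e_a ∈ E⁰`, `f_x ∈ E⁰` are represented by their preimages
`ea`, `fx` in `S⁰ = G`, and the displayed products are computed in `S⁰`.) -/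
theorem stmt10 {L R G : Type u} [Semigroup L] [Semigroup R] [Semigroup G]
    (jL : G → L) (jR : G → R)
    (hjL : Function.Injective jL) (hjR : Function.Injective jR)
    (hjLm : ∀ s t : G, jL (s * t) = jL s * jL t)
    (hjRm : ∀ s t : G, jR (s * t) = jR s * jR t)
    (hG : AdequateOn (mulOf G) Set.univ)
    (hL : LeftAdequateOn (mulOf L) Set.univ)
    (hR : RightAdequateOn (mulOf R) Set.univ)
    (TL : AdequateTransversalOn (mulOf L) Set.univ (Set.range jL))
    (TR : AdequateTransversalOn (mulOf R) Set.univ (Set.range jR))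
    (hQL : QuasiIdealOn (mulOf L) Set.univ (Set.range jL))
    (hQR : QuasiIdealOn (mulOf R) Set.univ (Set.range jR))
    (st : R → L → G)
    (cond1 : ∀ (y z : L) (a b : R),
      (∃ s : G, jL s = TL.bar y ∧ jR s = TR.bar b) →
      st (jR (st a y) * TR.f b) z = st a (TL.e y * jL (st b z)))
    (cond2L : ∀ (s : G) (x : L), jL (st (jR s) x) = jL s * x)
    (cond2R : ∀ (a : R) (s : G), jR (st a (jL s)) = a * jR s)
    :
    (∀ (a g : R) (x h : L), Idem (mulOf R) g → Idem (mulOf L) h →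
      TR.bar g = TR.f (TR.bar a) → TL.bar h = TL.e (TL.bar x) →
      ∀ ea fx : G, jR ea = TR.e a → jL fx = TL.f x →
        st (a * g) (h * x) = ea * st (a * g) (h * x) * fx) ∧
    (∀ (a : R) (x : L), ∀ ea fx : G, jR ea = TR.e a → jL fx = TL.f x →
        st a x = ea * st a x * fx) := by
  have main (a b : R) (x y : L) (ea fx : G) (hea : jR ea = TR.e a) (hfx : jL fx = TL.f x) :
      st (a * b) (y * x) = ea * st (a * b) (y * x) * fx := by
    rw [← star_mul_left hjL hjR hjLm hjRm hG TL TR cond1 cond2L cond2R hR,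
      ← star_mul_right hjL hjR hjLm hjRm hG TL TR cond1 cond2L cond2R hL,
      hea, hfx, ← mul_assoc, TR.e_mul_self, mul_assoc, TL.self_mul_f]
  refine ⟨fun a g x h _ _ _ _ ea fx hea hfx => main a g x h ea fx hea hfx,
    fun a x ea fx hea hfx => ?_⟩
  rw [← star_mul_left hjL hjR hjLm hjRm hG TL TR cond1 cond2L cond2R hR,
    ← star_mul_right hjL hjR hjLm hjRm hG TL TR cond1 cond2L cond2R hL,
    hea, hfx, TR.e_mul_self, TL.self_mul_f]
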